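/- arXiv:2506.16131 — 2 statements merged into one kernel-verified Lean document; each statement's English description precedes it below -/
import Mathlib

section
/- Define for complex s with Re(s) > 2 and ω > 0 the function G_s(ω) = ∫_{-ε+iℝ} (-t)^{s-1} / ((e^{2πit}-1)(e^{-2πiωt}-1)) dt with 0 < ε < min{1, 1/ω}. Then G_s(ω) = (2π)^{-s} Γ(s) ( e^{-sπi/2} ∑_{m≥0, n≥1} (m+nω)^{-s} − e^{sπi/2} ∑_{m≥1, n≥0} (m+nω)^{-s} ). -/
open MeasureTheory Complex

/-- The contour integral `G_s(ω) = ∫_{-ε+iℝ} (-t)^{s-1}/((e^{2πit}-1)(e^{-2πiωt}-1)) dt`,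
parametrized by `t = -ε + iu`, `u ∈ ℝ`; `(-t)^{s-1}` is the principal branch. -/
noncomputable def Gcont (s : ℂ) (ω ε : ℝ) : ℂ :=
  ∫ u : ℝ,
    Complex.I * ((-((-ε : ℂ) + u * Complex.I)) ^ (s - 1) /
      ((Complex.exp (2 * Real.pi * Complex.I * ((-ε : ℂ) + u * Complex.I)) - 1) *
       (Complex.exp (-(2 * Real.pi * Complex.I * ω * ((-ε : ℂ) + u * Complex.I))) - 1)))

theorem exp_sub_one_lower (η : ℝ) (h0 : 0 < η) (h1 : η < 1) :
    ∃ c : ℝ, 0 < c ∧ ∀ w : ℂ, 0 ≤ w.re → w.re ≤ η →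
      c * ‖w‖ * max 1 (Real.exp (-(2 * Real.pi * w.im))) ≤
        ‖Complex.exp (2 * Real.pi * Complex.I * w) - 1‖ * (1 + 2 * Real.pi * |w.im|) := by
  have hpi := Real.pi_pos
  have hsη : 0 < Real.sin (Real.pi * η) :=
    Real.sin_pos_of_pos_of_lt_pi (by positivity) (by nlinarith)
  set c0 := Real.sin (Real.pi * η) / η with hc0
  have hc0pos : 0 < c0 := by positivity
  refine ⟨min c0 (2 * Real.pi) / 2, by positivity, fun w hx hxη => ?_⟩
  set x := w.re with hxdef
  set y := w.im with hydef
  set r := Real.exp (-(2 * Real.pi * y)) with hr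
  have hrpos : 0 < r := Real.exp_pos _
  set M := max 1 r with hM
  have hM1 : 1 ≤ M := le_max_left _ _
  have hMr : r ≤ M := le_max_right _ _
  set N := ‖Complex.exp (2 * Real.pi * Complex.I * w) - 1‖ with hN
  have hNn : 0 ≤ N := norm_nonneg _
  -- concavity
  have hsin : c0 * x ≤ Real.sin (Real.pi * x) := by
    have hc := strictConcaveOn_sin_Icc.concaveOn.2
      (show (0 : ℝ) ∈ Set.Icc 0 Real.pi from ⟨le_rfl, hpi.le⟩)
      (show Real.pi * η ∈ Set.Icc 0 Real.pi from ⟨by positivity, by nlinarith⟩)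
      (show 0 ≤ 1 - x / η by rw [sub_nonneg, div_le_one h0]; exact hxη)
      (show 0 ≤ x / η by positivity) (by ring)
    simp only [smul_eq_mul, mul_zero, Real.sin_zero, zero_add] at hc
    have e1 : x / η * (Real.pi * η) = Real.pi * x := by field_simp
    rw [e1] at hc
    calc c0 * x = x / η * Real.sin (Real.pi * η) := by rw [hc0]; ring
      _ ≤ _ := hc
  have hNsq : N ^ 2 = (r - 1) ^ 2 + 4 * r * Real.sin (Real.pi * x) ^ 2 := by
    have e : Complex.exp (2 * Real.pi * Complex.I * w) =
        (r * Real.cos (2 * (Real.pi * x)) : ℝ) + (r * Real.sin (2 * (Real.pi * x)) : ℝ) * Complex.I := by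
      have : (2 * Real.pi * Complex.I * w : ℂ) = (-(2 * Real.pi * y) : ℝ) + (2 * (Real.pi * x) : ℝ) * Complex.I := by
        apply Complex.ext <;> simp [hxdef, hydef] <;> ring
      rw [this, Complex.exp_add, Complex.exp_mul_I, ← Complex.ofReal_exp, ← Complex.ofReal_cos,
        ← Complex.ofReal_sin, ← hr]
      push_cast; ring
    rw [hN, e, ← Complex.normSq_eq_norm_sq, Complex.normSq_apply]
    simp only [Complex.sub_re, Complex.add_re, Complex.ofReal_re, Complex.mul_re, Complex.I_re,
      Complex.ofReal_im, Complex.I_im, Complex.sub_im, Complex.add_im, Complex.mul_im,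
      Complex.one_re, Complex.one_im]
    rw [Real.cos_two_mul, Real.sin_two_mul]
    have := Real.sin_sq_add_cos_sq (Real.pi * x)
    have h2 : Real.cos (Real.pi * x) ^ 2 = 1 - Real.sin (Real.pi * x) ^ 2 := by linarith
    ring_nf
    rw [show Real.cos (Real.pi * x) ^ 4 = (Real.cos (Real.pi * x) ^ 2) ^ 2 by ring, h2]
    ring
  have hb1 : M * (c0 * x) ≤ N := by
    have hs0 : 0 ≤ Real.sin (Real.pi * x) := le_trans (by positivity) hsin
    have hs1 : Real.sin (Real.pi * x) ^ 2 ≤ 1 := by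
      nlinarith [Real.sin_le_one (Real.pi * x)]
    have hMs : M * Real.sin (Real.pi * x) ≤ N := by
      apply le_of_sq_le_sq _ hNn
      rw [hNsq]
      have hM2 : M ≤ r + 1 := max_le (by linarith) (by linarith)
      have : M ^ 2 ≤ (r + 1) ^ 2 := by gcongr
      nlinarith [sq_nonneg (r - 1), sq_nonneg (Real.sin (Real.pi * x))]
    exact le_trans (by gcongr) hMs
  have hb2 : M * (2 * Real.pi * |y|) ≤ N * (1 + 2 * Real.pi * |y|) := by
    have hNr : |r - 1| ≤ N := by
      apply abs_le_of_sq_le_sq _ hNn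
      rw [hNsq]; nlinarith [sq_nonneg (Real.sin (Real.pi * x))]
    set v := 2 * Real.pi * |y| with hv
    have hv0 : 0 ≤ v := by positivity
    have key : M * v ≤ |r - 1| * (1 + v) := by
      rcases le_total 0 y with hy | hy
      · have hr1 : r ≤ 1 := Real.exp_le_one_iff.2 (by nlinarith)
        have hvy : v = 2 * Real.pi * y := by rw [hv, abs_of_nonneg hy]
        rw [hM, max_eq_left hr1, abs_of_nonpos (by linarith)]
        have : r * (1 + v) ≤ 1 := by
          have := Real.add_one_le_exp v
          have h3 : r * Real.exp v = 1 := by rw [hr, ← Real.exp_add, hvy]; simp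
          nlinarith
        nlinarith
      · have hvy : v = -(2 * Real.pi * y) := by rw [hv, abs_of_nonpos hy]; ring
        have hr1 : 1 + v ≤ r := by rw [hr, hvy]; linarith [Real.add_one_le_exp (-(2 * Real.pi * y))]
        rw [hM, max_eq_right (by linarith), abs_of_nonneg (by linarith)]
        nlinarith
    exact key.trans (by gcongr)
  have hw : ‖w‖ ≤ x + |y| := by
    have := Complex.norm_le_abs_re_add_abs_im w
    rwa [← hxdef, ← hydef, abs_of_nonneg hx] at this
  have hm1 : min c0 (2 * Real.pi) ≤ c0 := min_le_left _ _
  have hm2 : min c0 (2 * Real.pi) ≤ 2 * Real.pi := min_le_right _ _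
  have hm0 : 0 < min c0 (2 * Real.pi) := by positivity
  set m := min c0 (2 * Real.pi)
  have hy0 := abs_nonneg y
  have hM0 : 0 ≤ M := by linarith
  calc m / 2 * ‖w‖ * M ≤ m / 2 * (x + |y|) * M := by gcongr
    _ = (M * (m * x) + M * (m * |y|)) / 2 := by ring
    _ ≤ (M * (c0 * x) + M * (2 * Real.pi * |y|)) / 2 := by gcongr
    _ ≤ (N + N * (1 + 2 * Real.pi * |y|)) / 2 := by gcongr
    _ ≤ N * (1 + 2 * Real.pi * |y|) := by
      have : 0 ≤ N * (2 * Real.pi * |y|) := by positivity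
      linarith

theorem poly_le_exp (r a : ℝ) (hr : 0 ≤ r) (ha : 0 < a) :
    ∃ C : ℝ, 0 < C ∧ ∀ y : ℝ, 0 ≤ y → (1 + y) ^ r ≤ C * Real.exp (a * y) := by
  set b := a / (r + 1) with hb
  have hb0 : 0 < b := by positivity
  set K := max 1 (1 / b) with hK
  have hK1 : 1 ≤ K := le_max_left _ _
  have hKb : 1 ≤ K * b := by
    have := le_max_right 1 (1 / b)
    calc 1 = 1 / b * b := by field_simp
      _ ≤ K * b := by gcongr
  refine ⟨K ^ (r + 1), by positivity, fun y hy => ?_⟩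
  have h1 : 1 + y ≤ K * Real.exp (b * y) := by
    have := Real.add_one_le_exp (b * y)
    calc 1 + y ≤ K * (b * y + 1) := by nlinarith
      _ ≤ _ := by gcongr
  calc (1 + y) ^ r ≤ (1 + y) ^ (r + 1) := Real.rpow_le_rpow_of_exponent_le (by linarith) (by linarith)
    _ ≤ (K * Real.exp (b * y)) ^ (r + 1) := by gcongr
    _ = _ := by
      rw [Real.mul_rpow (by positivity) (by positivity), ← Real.exp_mul]
      congr 2; rw [hb]; field_simp

theorem norm_rpow_split (p x y : ℝ) (hx : 0 ≤ x) (hx1 : x ≤ 1) (hy : y ≠ 0) :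
    ‖(x : ℂ) + y * Complex.I‖ ^ p ≤ |y| ^ p + (1 + |y|) ^ |p| := by
  have hy' : 0 < |y| := abs_pos.2 hy
  have hl : |y| ≤ ‖(x : ℂ) + y * Complex.I‖ := by
    have := Complex.abs_im_le_norm ((x : ℂ) + y * Complex.I)
    simpa using this
  have hu : ‖(x : ℂ) + y * Complex.I‖ ≤ 1 + |y| := by
    have := Complex.norm_le_abs_re_add_abs_im ((x : ℂ) + y * Complex.I)
    simp [abs_of_nonneg hx] at this
    linarith
  rcases le_total 0 p with hp | hp
  · rw [abs_of_nonneg hp]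
    have : ‖(x : ℂ) + y * Complex.I‖ ^ p ≤ (1 + |y|) ^ p := by gcongr
    have : 0 ≤ |y| ^ p := by positivity
    linarith
  · have := Real.rpow_le_rpow_of_nonpos hy' hl hp
    have : 0 ≤ (1 + |y|) ^ |p| := by positivity
    linarith

noncomputable def Fz (s : ℂ) (ω : ℝ) (z : ℂ) : ℂ :=
  z ^ (s - 1) / ((Complex.exp (-(2 * Real.pi * Complex.I * z)) - 1) *
    (Complex.exp (2 * Real.pi * Complex.I * (ω * z)) - 1))

set_option maxHeartbeats 1000000 in
theorem Fz_bound (s : ℂ) (ω : ℝ) (hω : 0 < ω)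
    (ε : ℝ) (hε : 0 < ε) (hε1 : ε < 1) (hεω : ε < 1 / ω) :
    ∃ C κ : ℝ, 0 < C ∧ 0 < κ ∧ ∀ x y : ℝ, 0 ≤ x → x ≤ ε → y ≠ 0 →
      ‖Fz s ω (x + y * Complex.I)‖ ≤ C * ((|y| ^ (s.re - 3) + 1) * Real.exp (-κ * |y|)) := by
  have hpi := Real.pi_pos
  have hωε : ω * ε < 1 := by rw [lt_div_iff₀ hω] at hεω; linarith
  obtain ⟨c1, hc1, H1⟩ := exp_sub_one_lower ε hε hε1
  obtain ⟨c2, hc2, H2⟩ := exp_sub_one_lower (ω * ε) (by positivity) hωε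
  set κ := min 1 ω with hκ
  have hκ0 : 0 < κ := by positivity
  obtain ⟨C3, hC3, H3⟩ := poly_le_exp (|s.re - 3| + 2) κ (by positivity) hκ0
  set K := Real.exp (Real.pi * |s.im|) with hK
  refine ⟨K / (c1 * (c2 * ω)) * ((1 + 2 * Real.pi) * (1 + 2 * Real.pi * ω)) * C3, κ,
    by positivity, hκ0, fun x y hx hxε hy => ?_⟩
  set z : ℂ := x + y * Complex.I with hz
  have hzre : z.re = x := by simp [hz]
  have hzim : z.im = y := by simp [hz]
  have hz0 : z ≠ 0 := fun h => hy (by rw [← hzim, h]; simp)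
  have hzn : 0 < ‖z‖ := norm_pos_iff.2 hz0
  have hay : 0 ≤ |y| := abs_nonneg y
  set d1 := ‖Complex.exp (-(2 * Real.pi * Complex.I * z)) - 1‖ with hd1
  set d2 := ‖Complex.exp (2 * Real.pi * Complex.I * (ω * z)) - 1‖ with hd2
  have B1 : c1 * ‖z‖ * max 1 (Real.exp (2 * Real.pi * y)) ≤ d1 * (1 + 2 * Real.pi * |y|) := by
    have h := H1 ((starRingEnd ℂ) z) (by simp [hzre, hx]) (by simp [hzre, hxε])
    have e : ‖Complex.exp (2 * Real.pi * Complex.I * (starRingEnd ℂ) z) - 1‖ = d1 := by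
      rw [hd1, ← Complex.norm_conj]
      congr 1
      rw [map_sub, map_one, ← Complex.exp_conj]
      simp [map_ofNat]
    rw [e] at h
    simpa [hzim] using h
  have B2 : c2 * (ω * ‖z‖) * max 1 (Real.exp (-(2 * Real.pi * (ω * y)))) ≤
      d2 * (1 + 2 * Real.pi * (ω * |y|)) := by
    have h := H2 (ω * z) (by simp [hzre]; positivity) (by simp [hzre]; gcongr)
    simpa [hzim, abs_mul, abs_of_pos hω] using h
  set P := (1 + 2 * Real.pi * |y|) * (1 + 2 * Real.pi * (ω * |y|)) with hP
  have hPpos : 0 < P := by positivity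
  have hE : Real.exp (2 * Real.pi * κ * |y|) ≤
      max 1 (Real.exp (2 * Real.pi * y)) * max 1 (Real.exp (-(2 * Real.pi * (ω * y)))) := by
    rcases le_total 0 y with h | h
    · rw [abs_of_nonneg h]
      calc Real.exp (2 * Real.pi * κ * y) ≤ Real.exp (2 * Real.pi * y) := by
            apply Real.exp_le_exp.2
            have : κ ≤ 1 := min_le_left _ _
            calc 2 * Real.pi * κ * y ≤ 2 * Real.pi * 1 * y := by gcongr
              _ = _ := by ring
        _ ≤ max 1 (Real.exp (2 * Real.pi * y)) * 1 := by rw [mul_one]; exact le_max_right _ _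
        _ ≤ _ := by gcongr; exact le_max_left _ _
    · rw [abs_of_nonpos h]
      calc Real.exp (2 * Real.pi * κ * -y) ≤ Real.exp (-(2 * Real.pi * (ω * y))) := by
            apply Real.exp_le_exp.2
            have h2 : κ ≤ ω := min_le_right _ _
            have h3 : 0 ≤ -y := by linarith
            calc 2 * Real.pi * κ * -y ≤ 2 * Real.pi * ω * -y := by gcongr
              _ = _ := by ring
        _ ≤ 1 * max 1 (Real.exp (-(2 * Real.pi * (ω * y)))) := by
            rw [one_mul]; exact le_max_right _ _
        _ ≤ _ := by gcongr; exact le_max_left _ _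
  have hden : c1 * (c2 * ω) * ‖z‖ ^ 2 * Real.exp (2 * Real.pi * κ * |y|) ≤ d1 * d2 * P := by
    calc c1 * (c2 * ω) * ‖z‖ ^ 2 * Real.exp (2 * Real.pi * κ * |y|)
        ≤ c1 * (c2 * ω) * ‖z‖ ^ 2 * (max 1 (Real.exp (2 * Real.pi * y)) *
          max 1 (Real.exp (-(2 * Real.pi * (ω * y))))) := by gcongr
      _ = (c1 * ‖z‖ * max 1 (Real.exp (2 * Real.pi * y))) *
          (c2 * (ω * ‖z‖) * max 1 (Real.exp (-(2 * Real.pi * (ω * y))))) := by ring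
      _ ≤ (d1 * (1 + 2 * Real.pi * |y|)) * (d2 * (1 + 2 * Real.pi * (ω * |y|))) := by gcongr
      _ = _ := by rw [hP]; ring
  have hdpos : 0 < d1 * d2 := by
    have : 0 < d1 * d2 * P := lt_of_lt_of_le (by positivity) hden
    exact pos_of_mul_pos_left this hPpos.le
  have hnum : ‖z ^ (s - 1)‖ ≤ ‖z‖ ^ (s.re - 3) * ‖z‖ ^ 2 * K := by
    have h := Complex.norm_cpow_le z (s - 1)
    have e : ‖z‖ ^ (s - 1).re = ‖z‖ ^ (s.re - 3) * ‖z‖ ^ 2 := by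
      rw [← Real.rpow_natCast, ← Real.rpow_add hzn]
      congr 1; simp; ring
    rw [e, div_eq_mul_inv, ← Real.exp_neg] at h
    refine h.trans ?_
    gcongr
    rw [hK]; apply Real.exp_le_exp.2
    calc -(arg z * (s - 1).im) ≤ |arg z * (s-1).im| := neg_le_abs _
      _ = |arg z| * |s.im| := by rw [abs_mul]; simp
      _ ≤ _ := by gcongr; exact Complex.abs_arg_le_pi z
  have hPle : P ≤ ((1 + 2 * Real.pi) * (1 + 2 * Real.pi * ω)) * (1 + |y|) ^ (2:ℝ) := by
    have h1 : 1 + 2 * Real.pi * |y| ≤ (1 + 2 * Real.pi) * (1 + |y|) := by nlinarith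
    have h2 : 1 + 2 * Real.pi * (ω * |y|) ≤ (1 + 2 * Real.pi * ω) * (1 + |y|) := by
      have : 0 < Real.pi * ω := by positivity
      nlinarith
    calc P ≤ ((1 + 2 * Real.pi) * (1 + |y|)) * ((1 + 2 * Real.pi * ω) * (1 + |y|)) := by
          rw [hP]; gcongr
      _ = _ := by rw [Real.rpow_two]; ring
  have hsplit := norm_rpow_split (s.re - 3) x y hx (by linarith) hy
  rw [← hz] at hsplit
  set Q := (1 + 2 * Real.pi) * (1 + 2 * Real.pi * ω) with hQ
  have hQ0 : 0 < Q := by positivity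
  have hA : ‖z‖ ^ (s.re - 3) * P ≤ Q * C3 * (|y| ^ (s.re - 3) + 1) * Real.exp (κ * |y|) := by
    have hone : 1 ≤ (1 + |y|) ^ |s.re - 3| := Real.one_le_rpow (by linarith) (abs_nonneg _)
    have hyp : 0 ≤ |y| ^ (s.re - 3) := by positivity
    calc ‖z‖ ^ (s.re - 3) * P ≤ (|y| ^ (s.re - 3) + (1 + |y|) ^ |s.re - 3|) *
          (Q * (1 + |y|) ^ (2:ℝ)) := by gcongr
      _ ≤ ((|y| ^ (s.re - 3) + 1) * (1 + |y|) ^ |s.re - 3|) * (Q * (1 + |y|) ^ (2:ℝ)) := by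
          gcongr; nlinarith
      _ = Q * (|y| ^ (s.re - 3) + 1) * (1 + |y|) ^ (|s.re - 3| + 2) := by
          rw [Real.rpow_add (by positivity)]; ring
      _ ≤ Q * (|y| ^ (s.re - 3) + 1) * (C3 * Real.exp (κ * |y|)) := by
          gcongr; exact H3 _ hay
      _ = _ := by ring
  have hF : ‖Fz s ω z‖ = ‖z ^ (s - 1)‖ / (d1 * d2) := by
    rw [Fz, norm_div, norm_mul]
  rw [hF, div_le_iff₀ hdpos]
  have hden' : ‖z‖ ^ 2 ≤ d1 * d2 * P / (c1 * (c2 * ω)) * Real.exp (-(2 * Real.pi * κ * |y|)) := by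
    rw [Real.exp_neg, ← div_eq_mul_inv, div_div, le_div_iff₀ (by positivity)]
    linarith
  have hexp : Real.exp (κ * |y|) * Real.exp (-(2 * Real.pi * κ * |y|)) ≤ Real.exp (-κ * |y|) := by
    rw [← Real.exp_add]; apply Real.exp_le_exp.2
    have h0 : 0 ≤ κ * |y| := by positivity
    have h3 : (2 * 1) * (κ * |y|) ≤ (2 * Real.pi) * (κ * |y|) := by
      gcongr; linarith [Real.pi_gt_three]
    have e1 : 2 * Real.pi * κ * |y| = (2 * Real.pi) * (κ * |y|) := by ring
    rw [e1, neg_mul]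
    linarith
  calc ‖z ^ (s - 1)‖ ≤ ‖z‖ ^ (s.re - 3) * ‖z‖ ^ 2 * K := hnum
    _ ≤ ‖z‖ ^ (s.re - 3) * (d1 * d2 * P / (c1 * (c2 * ω)) *
          Real.exp (-(2 * Real.pi * κ * |y|))) * K := by gcongr
    _ = K / (c1 * (c2 * ω)) * (d1 * d2) * Real.exp (-(2 * Real.pi * κ * |y|)) *
          (‖z‖ ^ (s.re - 3) * P) := by ring
    _ ≤ K / (c1 * (c2 * ω)) * (d1 * d2) * Real.exp (-(2 * Real.pi * κ * |y|)) *
          (Q * C3 * (|y| ^ (s.re - 3) + 1) * Real.exp (κ * |y|)) := by gcongr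
    _ = K / (c1 * (c2 * ω)) * (d1 * d2) * (Q * C3 * (|y| ^ (s.re - 3) + 1)) *
          (Real.exp (κ * |y|) * Real.exp (-(2 * Real.pi * κ * |y|))) := by ring
    _ ≤ K / (c1 * (c2 * ω)) * (d1 * d2) * (Q * C3 * (|y| ^ (s.re - 3) + 1)) *
          Real.exp (-κ * |y|) := by gcongr
    _ = _ := by ring

theorem exp_sub_one_ne (η : ℝ) (h0 : 0 < η) (h1 : η < 1) (w : ℂ) (hw : w ≠ 0)
    (hx : 0 ≤ w.re) (hx1 : w.re ≤ η) : Complex.exp (2 * Real.pi * Complex.I * w) - 1 ≠ 0 := by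
  obtain ⟨c, hc, H⟩ := exp_sub_one_lower η h0 h1
  have := H w hx hx1
  intro h
  rw [h, norm_zero, zero_mul] at this
  have h2 : 0 < ‖w‖ := norm_pos_iff.2 hw
  have : 0 < c * ‖w‖ * max 1 (Real.exp (-(2 * Real.pi * w.im))) := by positivity
  linarith

theorem Fz_diff (s : ℂ) (ω : ℝ) (hω : 0 < ω)
    (ε : ℝ) (hε : 0 < ε) (hε1 : ε < 1) (hεω : ε < 1 / ω) (z : ℂ) (hz : z ≠ 0)
    (hx : 0 ≤ z.re) (hx1 : z.re ≤ ε) : DifferentiableAt ℂ (Fz s ω) z := by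
  have hωε : ω * ε < 1 := by rw [lt_div_iff₀ hω] at hεω; linarith
  have hsl : z ∈ Complex.slitPlane := by
    rw [Complex.mem_slitPlane_iff]
    rcases hx.lt_or_eq with h | h
    · exact Or.inl h
    · right; intro h2; exact hz (Complex.ext h.symm h2)
  have hd2 : Complex.exp (2 * Real.pi * Complex.I * (ω * z)) - 1 ≠ 0 := by
    refine exp_sub_one_ne (ω * ε) (by positivity) hωε _ ?_ ?_ ?_
    · simp [hz, hω.ne']
    · simp; positivity
    · simp; gcongr
  have hd1 : Complex.exp (-(2 * Real.pi * Complex.I * z)) - 1 ≠ 0 := by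
    have h := exp_sub_one_ne ε hε hε1 ((starRingEnd ℂ) z) (by simpa using hz) (by simpa using hx)
      (by simpa using hx1)
    intro h2
    apply h
    have h3 := congrArg (starRingEnd ℂ) h2
    rw [map_sub, map_one, ← Complex.exp_conj] at h3
    simpa [map_ofNat] using h3
  unfold Fz
  refine DifferentiableAt.div ?_ (by fun_prop) (mul_ne_zero hd1 hd2)
  exact DifferentiableAt.cpow (by fun_prop) (by fun_prop) hsl

theorem Fz_meas (s : ℂ) (ω x : ℝ) :
    Measurable (fun y : ℝ => Fz s ω (x + y * Complex.I)) := by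
  unfold Fz
  fun_prop

theorem dom_integrable (p κ C : ℝ) (hp : -1 < p) (hκ : 0 < κ) :
    Integrable (fun y : ℝ => C * ((|y| ^ p + 1) * Real.exp (-κ * |y|))) := by
  apply Integrable.const_mul
  have h1 : IntegrableOn (fun y : ℝ => (|y| ^ p + 1) * Real.exp (-κ * |y|)) (Set.Ioi 0) := by
    have a1 := integrableOn_rpow_mul_exp_neg_mul_rpow (p := 1) hp one_pos hκ
    have a2 := integrableOn_rpow_mul_exp_neg_mul_rpow (p := 1) (s := 0) (by norm_num) one_pos hκ
    refine (a1.add a2).congr_fun (fun y hy => ?_) measurableSet_Ioi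
    have hy : 0 < y := hy
    simp [abs_of_pos hy]; ring
  have h2 : IntegrableOn (fun y : ℝ => (|y| ^ p + 1) * Real.exp (-κ * |y|)) (Set.Iio 0) := by
    have := IntegrableOn.comp_neg_Iio (c := 0) (f := fun y : ℝ => (|y| ^ p + 1) * Real.exp (-κ * |y|))
      (by simpa using h1)
    simpa using this
  rw [← integrableOn_univ, ← @Set.Iio_union_Ici _ _ (0 : ℝ), integrableOn_union,
    integrableOn_Ici_iff_integrableOn_Ioi]
  exact ⟨h2, h1⟩

theorem ae_ne_zero' : ∀ᵐ y : ℝ, y ≠ 0 := by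
  simp [ae_iff, measure_singleton]

theorem Fz_integrable (s : ℂ) (hs : 2 < s.re) (ω : ℝ) (hω : 0 < ω)
    (ε : ℝ) (hε : 0 < ε) (hε1 : ε < 1) (hεω : ε < 1 / ω) (x : ℝ) (hx : 0 ≤ x) (hxε : x ≤ ε) :
    Integrable (fun y : ℝ => Fz s ω (x + y * Complex.I)) := by
  obtain ⟨C, κ, hC, hκ, H⟩ := Fz_bound s ω hω ε hε hε1 hεω
  refine (dom_integrable (s.re - 3) κ C (by linarith) hκ).mono'
    (Fz_meas s ω x).aestronglyMeasurable ?_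
  filter_upwards [ae_ne_zero'] with y hy
  exact H x y hx hxε hy

open Filter Topology in
theorem dom_tendsto (p κ C : ℝ) (hκ : 0 < κ) :
    Tendsto (fun y : ℝ => C * ((|y| ^ p + 1) * Real.exp (-κ * |y|))) atTop (𝓝 0) := by
  have h1 := tendsto_rpow_mul_exp_neg_mul_atTop_nhds_zero p κ hκ
  have h2 := tendsto_rpow_mul_exp_neg_mul_atTop_nhds_zero 0 κ hκ
  have h3 := (h1.add h2).const_mul C
  simp only [add_zero, mul_zero] at h3
  refine h3.congr' ?_
  filter_upwards [eventually_gt_atTop 0] with y hy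
  rw [abs_of_pos hy, Real.rpow_zero]; ring

open Filter Topology in
theorem Fz_shift (s : ℂ) (hs : 2 < s.re) (ω : ℝ) (hω : 0 < ω)
    (ε : ℝ) (hε : 0 < ε) (hε1 : ε < 1) (hεω : ε < 1 / ω) (δ : ℝ) (hδ : 0 < δ) (hδε : δ ≤ ε) :
    ∫ y : ℝ, Fz s ω (ε + y * Complex.I) = ∫ y : ℝ, Fz s ω (δ + y * Complex.I) := by
  obtain ⟨C, κ, hC, hκ, H⟩ := Fz_bound s ω hω ε hε hε1 hεω
  set D := fun y : ℝ => C * ((|y| ^ (s.re - 3) + 1) * Real.exp (-κ * |y|)) with hD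
  have L1 := intervalIntegral_tendsto_integral
    (Fz_integrable s hs ω hω ε hε hε1 hεω ε hε.le le_rfl) tendsto_neg_atTop_atBot tendsto_id
  have L2 := intervalIntegral_tendsto_integral
    (Fz_integrable s hs ω hω ε hε hε1 hεω δ hδ.le hδε) tendsto_neg_atTop_atBot tendsto_id
  have side : ∀ T : ℝ, T ≠ 0 → ‖∫ x : ℝ in δ..ε, Fz s ω (x + T * Complex.I)‖ ≤ D T * (ε - δ) := by
    intro T hT
    have := intervalIntegral.norm_integral_le_of_norm_le_const (a := δ) (b := ε) (C := D T)
      (f := fun x : ℝ => Fz s ω (x + T * Complex.I)) (fun x hx => by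
        rw [Set.uIoc_of_le hδε] at hx
        exact H x T (hδ.le.trans hx.1.le) hx.2 hT)
    rwa [abs_of_nonneg (by linarith)] at this
  have hDT : Tendsto (fun T => D T * (ε - δ)) atTop (𝓝 0) := by
    simpa only [zero_mul] using (dom_tendsto (s.re - 3) κ C hκ).mul_const (ε - δ)
  have S1 : Tendsto (fun T : ℝ => ∫ x : ℝ in δ..ε, Fz s ω (x + T * Complex.I)) atTop (𝓝 0) := by
    refine squeeze_zero_norm' ?_ hDT
    filter_upwards [eventually_gt_atTop 0] with T hT using side T hT.ne'
  have S2 : Tendsto (fun T : ℝ => ∫ x : ℝ in δ..ε, Fz s ω (x + (-T : ℝ) * Complex.I)) atTop (𝓝 0) := by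
    refine squeeze_zero_norm' ?_ hDT
    filter_upwards [eventually_gt_atTop 0] with T hT
    have := side (-T) (by simpa using hT.ne')
    simpa [hD] using this
  have R : ∀ T : ℝ, (∫ x : ℝ in δ..ε, Fz s ω (x + (-T : ℝ) * Complex.I)) -
      (∫ x : ℝ in δ..ε, Fz s ω (x + T * Complex.I)) +
      Complex.I • (∫ y : ℝ in (-T)..T, Fz s ω (ε + y * Complex.I)) -
      Complex.I • (∫ y : ℝ in (-T)..T, Fz s ω (δ + y * Complex.I)) = 0 := by
    intro T
    have := Complex.integral_boundary_rect_eq_zero_of_differentiableOn (Fz s ω) (⟨δ, -T⟩) (⟨ε, T⟩)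
      (fun z hz => by
        have hz1 := hz.1
        simp only [Set.mem_preimage, Set.uIcc_of_le hδε, Set.mem_Icc] at hz1
        refine (Fz_diff s ω hω ε hε hε1 hεω z ?_ (by linarith [hz1.1]) hz1.2).differentiableWithinAt
        rintro rfl
        simp at hz1; linarith)
    exact this
  have LT := ((S2.sub S1).add (L1.const_smul Complex.I)).sub (L2.const_smul Complex.I)
  have h0 := tendsto_nhds_unique (LT.congr (fun T => R T)) tendsto_const_nhds
  simp only [smul_eq_mul, sub_zero, zero_add] at h0
  rw [← mul_sub] at h0
  rcases mul_eq_zero.1 h0 with h | h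
  · exact absurd h Complex.I_ne_zero
  · exact sub_eq_zero.1 h

open Filter Topology in
theorem Fz_shift_zero (s : ℂ) (hs : 2 < s.re) (ω : ℝ) (hω : 0 < ω)
    (ε : ℝ) (hε : 0 < ε) (hε1 : ε < 1) (hεω : ε < 1 / ω) :
    ∫ y : ℝ, Fz s ω (ε + y * Complex.I) = ∫ y : ℝ, Fz s ω ((0 : ℝ) + y * Complex.I) := by
  obtain ⟨C, κ, hC, hκ, H⟩ := Fz_bound s ω hω ε hε hε1 hεω
  have hev : ∀ᶠ δ in 𝓝[>] (0 : ℝ), 0 < δ ∧ δ ≤ ε := Ioc_mem_nhdsGT hε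
  have L : Tendsto (fun δ : ℝ => ∫ y : ℝ, Fz s ω (δ + y * Complex.I)) (𝓝[>] 0)
      (𝓝 (∫ y : ℝ, Fz s ω ((0 : ℝ) + y * Complex.I))) := by
    refine tendsto_integral_filter_of_dominated_convergence
      (fun y : ℝ => C * ((|y| ^ (s.re - 3) + 1) * Real.exp (-κ * |y|)))
      (Eventually.of_forall fun δ => (Fz_meas s ω δ).aestronglyMeasurable) ?_
      (dom_integrable (s.re - 3) κ C (by linarith) hκ) ?_
    · filter_upwards [hev] with δ hδ
      filter_upwards [ae_ne_zero'] with y hy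
      exact H δ y hδ.1.le hδ.2 hy
    · filter_upwards [ae_ne_zero'] with y hy
      have hc : ContinuousAt (Fz s ω) ((0 : ℝ) + y * Complex.I) :=
        (Fz_diff s ω hω ε hε hε1 hεω _ (by simpa using hy) (by simp) (by simpa using hε.le)).continuousAt
      have hg : ContinuousAt (fun δ : ℝ => (δ : ℂ) + y * Complex.I) 0 := by fun_prop
      exact (ContinuousAt.comp (f := fun δ : ℝ => (δ : ℂ) + y * Complex.I) hc hg).tendsto.mono_left
        nhdsWithin_le_nhds
  refine (tendsto_nhds_unique L ?_).symm
  refine tendsto_const_nhds.congr' ?_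
  filter_upwards [hev] with δ hδ
  exact Fz_shift s hs ω hω ε hε hε1 hεω δ hδ.1 hδ.2

theorem summable_lattice (σ A B : ℝ) (hσ : 2 < σ) (hA : 0 < A) (hB : 0 < B) :
    Summable fun p : ℕ × ℕ => 1 / (((p.1 : ℝ) + 1) * A + p.2 * B) ^ σ := by
  have h1 : Summable fun n : ℕ => 1 / ((n : ℝ) + 1) ^ (σ / 2) := by
    have := (Real.summable_one_div_nat_add_rpow 1 (σ / 2)).2 (by linarith)
    refine this.congr fun n => ?_
    rw [abs_of_pos (by positivity)]
  have h2 := (summable_mul_of_summable_norm h1.norm h1.norm).mul_left (1 / (min A B) ^ σ)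
  have hk : 0 < min A B := lt_min hA hB
  refine Summable.of_nonneg_of_le (fun p => by positivity) (fun p => ?_) h2
  set k := min A B
  have hm : (0 : ℝ) ≤ p.1 := by positivity
  have hn : (0 : ℝ) ≤ p.2 := by positivity
  obtain ⟨m', n'⟩ := p
  simp only at hm hn ⊢
  generalize (m' : ℝ) = m at *
  generalize (n' : ℝ) = n at *
  have e : ((m + 1) * (n + 1)) ^ (σ / 2) ≤ (m + n + 1) ^ σ := by
    calc ((m + 1) * (n + 1)) ^ (σ / 2) ≤ ((m + n + 1) ^ (2 : ℝ)) ^ (σ / 2) := by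
          gcongr
          rw [Real.rpow_two]; nlinarith
      _ = _ := by rw [← Real.rpow_mul (by positivity)]; congr 1; ring
  have e2 : k * (m + n + 1) ≤ (m + 1) * A + n * B := by
    have hkA : k ≤ A := min_le_left _ _
    have hkB : k ≤ B := min_le_right _ _
    calc k * (m + n + 1) = (m + 1) * k + n * k := by ring
      _ ≤ _ := by gcongr
  calc 1 / ((m + 1) * A + n * B) ^ σ ≤ 1 / (k * (m + n + 1)) ^ σ := by gcongr
    _ = 1 / k ^ σ * (1 / (m + n + 1) ^ σ) := by
      rw [Real.mul_rpow (by positivity) (by positivity)]; field_simp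
    _ ≤ 1 / k ^ σ * (1 / ((m + 1) * (n + 1)) ^ (σ / 2)) := by gcongr
    _ = _ := by
      rw [Real.mul_rpow (by positivity) (by positivity)]; field_simp

theorem geom_double (A B : ℝ) (hA : 0 < A) (hB : 0 < B) :
    HasSum (fun p : ℕ × ℕ => Real.exp (-(((p.1 : ℝ) + 1) * A + p.2 * B)))
      (-(1 / ((Real.exp A - 1) * (Real.exp (-B) - 1)))) := by
  have ha : Real.exp (-A) < 1 := by simpa using hA
  have hb : Real.exp (-B) < 1 := by simpa using hB
  have h1 : HasSum (fun m : ℕ => Real.exp (-(((m : ℝ) + 1) * A))) (Real.exp (-A) * (1 - Real.exp (-A))⁻¹) := by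
    refine ((hasSum_geometric_of_lt_one (Real.exp_pos _).le ha).mul_left (Real.exp (-A))).congr_fun ?_
    intro m
    rw [← Real.exp_nat_mul, ← Real.exp_add]; congr 1; ring
  have h2 : HasSum (fun n : ℕ => Real.exp (-(n * B))) ((1 - Real.exp (-B))⁻¹) := by
    refine (hasSum_geometric_of_lt_one (Real.exp_pos _).le hb).congr_fun ?_
    intro m
    rw [← Real.exp_nat_mul]; congr 1; ring
  have h3 := h1.mul h2 (summable_mul_of_summable_norm h1.summable.norm h2.summable.norm)
  have hA1 : 1 < Real.exp A := by simpa using hA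
  have e : Real.exp (-A) * (1 - Real.exp (-A))⁻¹ * (1 - Real.exp (-B))⁻¹ =
      -(1 / ((Real.exp A - 1) * (Real.exp (-B) - 1))) := by
    have hne : 1 - Real.exp (-B) ≠ 0 := by linarith
    have hne' : Real.exp (-B) - 1 ≠ 0 := by linarith
    have hne2 : Real.exp A - 1 ≠ 0 := by linarith
    have : Real.exp (-A) * (1 - Real.exp (-A))⁻¹ = (Real.exp A - 1)⁻¹ := by
      rw [Real.exp_neg]
      have := (Real.exp_pos A).ne'
      field_simp
    rw [this]
    rw [show 1 - Real.exp (-B) = -(Real.exp (-B) - 1) by ring]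
    field_simp
  rw [e] at h3
  refine h3.congr_fun fun p => ?_
  rw [← Real.exp_add]; congr 1; ring

theorem mellin_double (s : ℂ) (hs : 2 < s.re) (A B : ℝ) (hA : 0 < A) (hB : 0 < B) :
    ∫ y : ℝ in Set.Ioi 0, (y : ℂ) ^ (s - 1) *
      (1 / ((Complex.exp (A * y) - 1) * (Complex.exp (-(B * y)) - 1))) =
    -(∑' p : ℕ × ℕ, Complex.Gamma s * (((p.1 : ℂ) + 1) * A + p.2 * B) ^ (-s)) := by
  have h := hasSum_mellin (ι := ℕ × ℕ) (a := fun _ => 1)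
    (p := fun p : ℕ × ℕ => ((p.1 : ℝ) + 1) * A + p.2 * B) (s := s)
    (F := fun y : ℝ => -(1 / ((Complex.exp (A * y) - 1) * (Complex.exp (-(B * y)) - 1))))
    (fun p => Or.inr (by positivity)) (by linarith) (fun t ht => by
      have ht : 0 < t := ht
      have := Complex.hasSum_ofReal.2 (geom_double (A * t) (B * t) (by positivity) (by positivity))
      push_cast at this ⊢
      refine this.congr_fun fun p => ?_
      rw [one_mul]; congr 1; ring)
    (by simpa using summable_lattice s.re A B hs hA hB)
  have h' := h.tsum_eq
  rw [mellin] at h'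
  simp only [smul_eq_mul, mul_neg] at h'
  rw [integral_neg] at h'
  rw [← neg_neg (integral _ _), ← h']
  congr 1
  refine tsum_congr fun p => ?_
  rw [Complex.cpow_neg]
  push_cast
  rw [mul_one, div_eq_mul_inv]

theorem real_mul_cpow (y : ℝ) (hy : 0 < y) (w : ℂ) (hw : w ≠ 0) (t : ℂ) :
    ((y : ℂ) * w) ^ t = w ^ t * (y : ℂ) ^ t := by
  have hy' : (y : ℂ) ≠ 0 := by exact_mod_cast hy.ne'
  rw [Complex.cpow_def_of_ne_zero (mul_ne_zero hy' hw), Complex.cpow_def_of_ne_zero hw,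
    Complex.cpow_def_of_ne_zero hy', Complex.log_ofReal_mul hy hw, ← Complex.exp_add,
    Complex.ofReal_log hy.le]
  congr 1; ring

theorem I_mul_cpow (s : ℂ) :
    Complex.I * Complex.I ^ (s - 1) = Complex.exp (s * Real.pi * Complex.I / 2) := by
  rw [Complex.cpow_sub _ _ Complex.I_ne_zero, Complex.cpow_one,
    mul_div_cancel₀ _ Complex.I_ne_zero, Complex.cpow_def_of_ne_zero Complex.I_ne_zero,
    Complex.log_I]
  congr 1; ring

theorem neg_I_mul_cpow (s : ℂ) :
    Complex.I * (-Complex.I) ^ (s - 1) = -Complex.exp (-s * Real.pi * Complex.I / 2) := by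
  have h0 : -Complex.I ≠ 0 := neg_ne_zero.2 Complex.I_ne_zero
  have : (-Complex.I) * (-Complex.I) ^ (s - 1) = Complex.exp (-s * Real.pi * Complex.I / 2) := by
    rw [Complex.cpow_sub _ _ h0, Complex.cpow_one, mul_div_cancel₀ _ h0, Complex.cpow_def_of_ne_zero h0, Complex.log_neg_I]
    congr 1; ring
  rw [← this]; ring

theorem scale_tsum (s : ℂ) (q : ℕ × ℕ → ℝ) (hq : ∀ p, 0 ≤ q p) :
    ∑' p : ℕ × ℕ, Complex.Gamma s * (((2 * Real.pi : ℝ) : ℂ) * (q p : ℂ)) ^ (-s) =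
      (2 * Real.pi : ℂ) ^ (-s) * Complex.Gamma s * ∑' p : ℕ × ℕ, (q p : ℂ) ^ (-s) := by
  rw [← tsum_mul_left]
  refine tsum_congr fun p => ?_
  rw [Complex.mul_cpow_ofReal_nonneg (by positivity) (hq p)]
  push_cast; ring

theorem Fz_half_pos (s : ℂ) (hs : 2 < s.re) (ω : ℝ) (hω : 0 < ω) :
    Complex.I * ∫ y : ℝ in Set.Ioi 0, Fz s ω ((0 : ℝ) + y * Complex.I) =
      -((2 * Real.pi : ℂ) ^ (-s) * Complex.Gamma s * (Complex.exp (s * Real.pi * Complex.I / 2) *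
            (∑' p : ℕ × ℕ, (((p.1 : ℂ) + 1) + (p.2 : ℂ) * ω) ^ (-s)))) := by
  have hpi := Real.pi_pos
  have h := mellin_double s hs (2 * Real.pi) (2 * Real.pi * ω) (by positivity) (by positivity)
  have e1 : ∀ y ∈ Set.Ioi (0 : ℝ), Fz s ω ((0 : ℝ) + y * Complex.I) =
      Complex.I ^ (s - 1) * ((y : ℂ) ^ (s - 1) *
      (1 / ((Complex.exp ((2 * Real.pi : ℝ) * y) - 1) *
        (Complex.exp (-((2 * Real.pi * ω : ℝ) * y)) - 1)))) := by
    intro y hy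
    rw [Fz, Complex.ofReal_zero, zero_add, real_mul_cpow y hy _ Complex.I_ne_zero]
    have a1 : -(2 * Real.pi * Complex.I * (y * Complex.I)) = ((2 * Real.pi : ℝ) : ℂ) * y := by
      push_cast; linear_combination (-2 * Real.pi * y : ℂ) * Complex.I_mul_I
    have a2 : 2 * Real.pi * Complex.I * (ω * (y * Complex.I)) =
        -(((2 * Real.pi * ω : ℝ) : ℂ) * y) := by
      push_cast; linear_combination (2 * Real.pi * ω * y : ℂ) * Complex.I_mul_I
    rw [a1, a2]; ring
  have e2 := scale_tsum s (fun p => ((p.1 : ℝ) + 1) + (p.2 : ℝ) * ω) (fun p => by positivity)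
  rw [setIntegral_congr_fun measurableSet_Ioi e1, integral_const_mul, h, ← mul_assoc, I_mul_cpow]
  have e3 : ∑' p : ℕ × ℕ, Complex.Gamma s * (((p.1 : ℂ) + 1) * (2 * Real.pi : ℝ) +
      p.2 * (2 * Real.pi * ω : ℝ)) ^ (-s) = (2 * Real.pi : ℂ) ^ (-s) * Complex.Gamma s *
        ∑' p : ℕ × ℕ, (((p.1 : ℂ) + 1) + (p.2 : ℂ) * ω) ^ (-s) := by
    push_cast at e2 ⊢
    rw [← e2]
    refine tsum_congr fun p => ?_
    congr 2; ring
  rw [e3]; ring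

theorem Fz_half_neg (s : ℂ) (hs : 2 < s.re) (ω : ℝ) (hω : 0 < ω) :
    Complex.I * ∫ y : ℝ in Set.Ioi 0, Fz s ω ((0 : ℝ) + (-y : ℝ) * Complex.I) =
      (2 * Real.pi : ℂ) ^ (-s) * Complex.Gamma s * (Complex.exp (-s * Real.pi * Complex.I / 2) *
            (∑' p : ℕ × ℕ, ((p.1 : ℂ) + ((p.2 : ℂ) + 1) * ω) ^ (-s))) := by
  have hpi := Real.pi_pos
  have h := mellin_double s hs (2 * Real.pi * ω) (2 * Real.pi) (by positivity) (by positivity)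
  have e1 : ∀ y ∈ Set.Ioi (0 : ℝ), Fz s ω ((0 : ℝ) + (-y : ℝ) * Complex.I) =
      (-Complex.I) ^ (s - 1) * ((y : ℂ) ^ (s - 1) *
      (1 / ((Complex.exp ((2 * Real.pi * ω : ℝ) * y) - 1) *
        (Complex.exp (-((2 * Real.pi : ℝ) * y)) - 1)))) := by
    intro y hy
    have a0 : ((-y : ℝ) : ℂ) * Complex.I = y * (-Complex.I) := by push_cast; ring
    rw [Fz, Complex.ofReal_zero, zero_add, a0,
      real_mul_cpow y hy _ (neg_ne_zero.2 Complex.I_ne_zero)]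
    have a1 : -(2 * Real.pi * Complex.I * (y * -Complex.I)) = -(((2 * Real.pi : ℝ) : ℂ) * y) := by
      push_cast; linear_combination (2 * Real.pi * y : ℂ) * Complex.I_mul_I
    have a2 : 2 * Real.pi * Complex.I * (ω * (y * -Complex.I)) =
        (((2 * Real.pi * ω : ℝ) : ℂ) * y) := by
      push_cast; linear_combination (-2 * Real.pi * ω * y : ℂ) * Complex.I_mul_I
    rw [a1, a2]; ring
  have e2 := scale_tsum s (fun p => (p.1 : ℝ) + ((p.2 : ℝ) + 1) * ω) (fun p => by positivity)
  rw [setIntegral_congr_fun measurableSet_Ioi e1, integral_const_mul, h, ← mul_assoc,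
    neg_I_mul_cpow]
  have e3 : ∑' p : ℕ × ℕ, Complex.Gamma s * (((p.1 : ℂ) + 1) * (2 * Real.pi * ω : ℝ) +
      p.2 * (2 * Real.pi : ℝ)) ^ (-s) = (2 * Real.pi : ℂ) ^ (-s) * Complex.Gamma s *
        ∑' p : ℕ × ℕ, ((p.1 : ℂ) + ((p.2 : ℂ) + 1) * ω) ^ (-s) := by
    push_cast at e2 ⊢
    rw [← e2, ← (Equiv.prodComm ℕ ℕ).tsum_eq]
    refine tsum_congr fun p => ?_
    simp only [Equiv.prodComm_apply, Prod.fst_swap, Prod.snd_swap]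
    congr 2; ring
  rw [e3]; ring

theorem Gcont_series (s : ℂ) (hs : 2 < s.re) (ω : ℝ) (hω : 0 < ω)
    (ε : ℝ) (hε : 0 < ε) (hε1 : ε < 1) (hεω : ε < 1 / ω) :
    Gcont s ω ε =
      (2 * Real.pi : ℂ) ^ (-s) * Complex.Gamma s *
        (Complex.exp (-s * Real.pi * Complex.I / 2) *
            (∑' p : ℕ × ℕ, ((p.1 : ℂ) + ((p.2 : ℂ) + 1) * ω) ^ (-s)) -
          Complex.exp (s * Real.pi * Complex.I / 2) *
            (∑' p : ℕ × ℕ, (((p.1 : ℂ) + 1) + (p.2 : ℂ) * ω) ^ (-s))) := by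
  have h1 : Gcont s ω ε = Complex.I * ∫ y : ℝ, Fz s ω (ε + y * Complex.I) := by
    rw [Gcont, integral_const_mul, ← integral_neg_eq_self]
    congr 1
    refine integral_congr_ae (Filter.Eventually.of_forall fun u => ?_)
    simp only [Fz]
    push_cast
    congr 3
    · ring
    · congr 2; ring
    · congr 2; ring
  have hint := Fz_integrable s hs ω hω ε hε hε1 hεω 0 le_rfl hε.le
  have hsplit := intervalIntegral.integral_Iic_add_Ioi (b := 0) hint.integrableOn hint.integrableOn
  have hneg := integral_comp_neg_Ioi 0 (fun y : ℝ => Fz s ω ((0 : ℝ) + y * Complex.I))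
  rw [neg_zero] at hneg
  rw [h1, Fz_shift_zero s hs ω hω ε hε hε1 hεω, ← hsplit, mul_add, ← hneg,
    Fz_half_neg s hs ω hω, Fz_half_pos s hs ω hω]
  ring
end

section
/- For even integers k ≥ 2, G_k(ω) = ((k-1)!/(2πi)^k) ζ(k) (ω^{-k} − 1) − δ_{k,2}/(4πiω), where G_k(ω) = ∫_{-ε+iℝ} (-t)^{k-1}/((e^{2πit}-1)(e^{-2πiωt}-1)) dt with ω > 0 and 0 < ε < min{1, 1/ω}. -/
open MeasureTheory Complex

open Set Filter Topology in
lemma aux_zeta (k : ℕ) (hk : 2 ≤ k) (p : ℝ) (hp : 0 < p) :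
    IntegrableOn (fun v : ℝ => (v : ℂ) ^ (k - 1) * (Complex.exp (p * v) - 1)⁻¹) (Ioi 0) ∧
    ∫ v in Ioi (0 : ℝ), (v : ℂ) ^ (k - 1) * (Complex.exp (p * v) - 1)⁻¹ =
      ((k - 1).factorial : ℂ) * riemannZeta k / p ^ k := by
  have hk1 : 1 < ((k : ℂ)).re := by
    simp only [natCast_re]; exact_mod_cast hk
  have hcast : (k : ℂ) - 1 = ((k - 1 : ℕ) : ℂ) := by
    rw [Nat.cast_sub (by omega)]; simp
  have key := hasSum_mellin (ι := ℕ) (a := fun _ => 1) (p := fun i => p * (i + 1))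
    (F := fun t => (Complex.exp (p * t) - 1)⁻¹) (s := k)
    (fun i => Or.inr (by positivity)) (by linarith) ?_ ?_
  rotate_left
  · intro t ht
    have ht : 0 < t := ht
    have hlt : Real.exp (-(p * t)) < 1 := by
      rw [Real.exp_lt_one_iff]; have := mul_pos hp ht; linarith
    have hg := hasSum_geometric_of_lt_one (Real.exp_pos (-(p * t))).le hlt
    have hg2 := (hg.mul_left (Real.exp (-(p * t))))
    have hg3 := Complex.hasSum_ofReal.mpr hg2
    convert! hg3 using 1
    · ext i
      rw [one_mul, ← Real.exp_nat_mul, ← Real.exp_add]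
      congr 2
      ring
    · have h1 : Real.exp (p * t) ≠ 0 := (Real.exp_pos _).ne'
      have h2 : 1 < Real.exp (p * t) := Real.one_lt_exp_iff.mpr (mul_pos hp ht)
      have : Real.exp (-(p * t)) * (1 - Real.exp (-(p * t)))⁻¹ = (Real.exp (p * t) - 1)⁻¹ := by
        rw [Real.exp_neg]
        have h3 : Real.exp (p * t) - 1 ≠ 0 := by linarith
        field_simp
      rw [this]
      push_cast
      rfl
  · have h1 : Summable (fun n : ℕ => 1 / ((n + 1 : ℕ) : ℝ) ^ k) :=
      (summable_nat_add_iff 1 (f := fun n : ℕ => 1 / (n : ℝ) ^ k)).mpr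
        (Real.summable_one_div_nat_pow.mpr (by omega))
    refine (h1.mul_left (1 / p ^ k)).congr fun i => ?_
    simp only [natCast_re, Real.rpow_natCast, norm_one, mul_pow]
    push_cast
    field_simp
  have hval : mellin (fun t : ℝ => (Complex.exp (p * t) - 1)⁻¹) k =
      ((k - 1).factorial : ℂ) * riemannZeta k / p ^ k := by
    rw [← key.tsum_eq, zeta_eq_tsum_one_div_nat_add_one_cpow hk1, mul_div_right_comm,
      ← tsum_mul_left]
    congr 1
    ext i
    have hG : Complex.Gamma k = ((k - 1).factorial : ℂ) := by
      rw [← Complex.Gamma_nat_eq_factorial, ← hcast]; simp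
    rw [hG]
    simp only [cpow_natCast]
    push_cast
    rw [mul_pow]
    have : (i : ℂ) + 1 ≠ 0 := by exact_mod_cast Nat.succ_ne_zero i
    have : (p : ℂ) ≠ 0 := by exact_mod_cast hp.ne'
    field_simp
  have hI : ∫ v in Ioi (0 : ℝ), (v : ℂ) ^ (k - 1) * (Complex.exp (p * v) - 1)⁻¹ =
      ((k - 1).factorial : ℂ) * riemannZeta k / p ^ k := by
    rw [← hval, mellin, hcast]
    simp only [cpow_natCast, smul_eq_mul]
  refine ⟨Integrable.of_integral_ne_zero ?_, hI⟩
  rw [hI]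
  have : riemannZeta k ≠ 0 := riemannZeta_ne_zero_of_one_le_re hk1.le
  have : (p : ℂ) ≠ 0 := by exact_mod_cast hp.ne'
  have : ((k - 1).factorial : ℂ) ≠ 0 := by exact_mod_cast Nat.factorial_ne_zero _
  positivity

lemma aux_bound (p q : ℝ) (hp : 0 < p) (hq : 0 < q) (n : ℕ) (hn : n ≠ 0) :
    ∃ c > 0, ∀ u : ℝ, 1 ≤ u →
      c * u ^ n ≤ (1 - Real.exp (-(p * u))) * (Real.exp (q * u) - 1) := by
  have h1 : 0 < 1 - Real.exp (-p) := by
    have : Real.exp (-p) < 1 := Real.exp_lt_one_iff.mpr (by linarith)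
    linarith
  refine ⟨(1 - Real.exp (-p)) * (q ^ n / n.factorial), by positivity, fun u hu => ?_⟩
  have h2 : Real.exp (-(p * u)) ≤ Real.exp (-p) := Real.exp_le_exp.mpr (by nlinarith)
  have h3 : (q * u) ^ n / n.factorial ≤ Real.exp (q * u) - 1 := by
    have hx : 0 ≤ q * u := by positivity
    have := Real.sum_le_exp_of_nonneg hx (n + 1)
    rw [Finset.sum_range_succ] at this
    obtain ⟨m, rfl⟩ := Nat.exists_eq_succ_of_ne_zero hn
    have h4 : (1 : ℝ) ≤ ∑ i ∈ Finset.range (m + 1), (q * u) ^ i / i.factorial := by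
      rw [Finset.sum_range_succ']
      simp only [pow_zero, Nat.factorial_zero, Nat.cast_one, div_one]
      have : 0 ≤ ∑ i ∈ Finset.range m, (q * u) ^ (i+1) / (i+1).factorial :=
        Finset.sum_nonneg fun i _ => by positivity
      linarith
    simp only [Nat.succ_eq_add_one] at *
    linarith
  rw [mul_pow] at h3
  calc (1 - Real.exp (-p)) * (q ^ n / n.factorial) * u ^ n
      = (1 - Real.exp (-p)) * (q ^ n * u ^ n / n.factorial) := by ring
    _ ≤ _ := mul_le_mul (by linarith) h3 (by positivity) (by linarith)

noncomputable def fG (n : ℕ) (ω : ℝ) (t : ℂ) : ℂ :=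
  -(t ^ (n + 1)) / ((Complex.exp (2 * Real.pi * Complex.I * t) - 1) *
    (Complex.exp (-(2 * Real.pi * Complex.I * ω * t)) - 1))

noncomputable def DD (x : ℂ) : ℂ := dslope Complex.exp 0 x

noncomputable def hG (n : ℕ) (ω : ℝ) (t : ℂ) : ℂ :=
  t ^ n / (DD (2 * Real.pi * Complex.I * t) * DD (-(2 * Real.pi * Complex.I * ω * t)))

noncomputable def gG (n : ℕ) (ω : ℝ) (t : ℂ) : ℂ :=
  -1 / (4 * Real.pi ^ 2 * ω) * dslope (hG n ω) 0 t

def stripG (ω : ℝ) : Set ℂ := {t : ℂ | |t.re| < 1 ∧ |ω * t.re| < 1}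

lemma isOpen_stripG (ω : ℝ) : IsOpen (stripG ω) := by
  have h1 : IsOpen {t : ℂ | |t.re| < 1} := isOpen_lt (by fun_prop) (by fun_prop)
  have h2 : IsOpen {t : ℂ | |ω * t.re| < 1} := isOpen_lt (by fun_prop) (by fun_prop)
  exact h1.inter h2

lemma exp_ne_one_aux {x : ℂ} (hx : |x.im| < 2 * Real.pi) (h0 : x ≠ 0) : Complex.exp x - 1 ≠ 0 := by
  intro h
  rw [sub_eq_zero, Complex.exp_eq_one_iff] at h
  obtain ⟨m, rfl⟩ := h
  have him : ((m : ℂ) * (2 * Real.pi * Complex.I)).im = m * (2 * Real.pi) := by simp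
  rw [him, abs_mul, abs_of_pos Real.two_pi_pos] at hx
  have h1 : |(m : ℝ)| < 1 := by
    by_contra hc
    push Not at hc
    nlinarith [Real.two_pi_pos]
  have h2 : m = 0 := by
    have : |m| < 1 := by exact_mod_cast h1
    exact Int.abs_lt_one_iff.mp this
  simp [h2] at h0

lemma DD_zero : DD 0 = 1 := by
  simp [DD, dslope_same]

lemma DD_of_ne {x : ℂ} (h : x ≠ 0) : DD x = (Complex.exp x - 1) / x := by
  simp [DD, dslope_of_ne _ h, slope_def_field]

lemma DD_ne_zero {x : ℂ} (hx : |x.im| < 2 * Real.pi) : DD x ≠ 0 := by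
  by_cases h0 : x = 0
  · simp [h0, DD_zero]
  · rw [DD_of_ne h0]
    exact div_ne_zero (exp_ne_one_aux hx h0) h0

lemma DD_diff : Differentiable ℂ DD := by
  have := (Complex.differentiableOn_dslope (f := Complex.exp) (c := 0) (s := Set.univ)
    Filter.univ_mem).mpr Complex.differentiable_exp.differentiableOn
  exact differentiableOn_univ.mp this

lemma a_im (t : ℂ) : |(2 * Real.pi * Complex.I * t).im| = 2 * Real.pi * |t.re| := by
  have : (2 * Real.pi * Complex.I * t).im = 2 * Real.pi * t.re := by simp
  rw [this, abs_mul, abs_of_pos Real.two_pi_pos]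

lemma b_im (ω : ℝ) (t : ℂ) :
    |(-(2 * Real.pi * Complex.I * ω * t)).im| = 2 * Real.pi * |ω * t.re| := by
  have : (-(2 * Real.pi * Complex.I * ω * t)).im = -(2 * Real.pi * (ω * t.re)) := by
    simp; ring
  rw [this, abs_neg, abs_mul, abs_of_pos Real.two_pi_pos]

lemma a_lt {ω : ℝ} {t : ℂ} (ht : t ∈ stripG ω) :
    |(2 * Real.pi * Complex.I * t).im| < 2 * Real.pi := by
  rw [a_im]; have := ht.1; nlinarith [Real.two_pi_pos]

lemma b_lt {ω : ℝ} {t : ℂ} (ht : t ∈ stripG ω) :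
    |(-(2 * Real.pi * Complex.I * ω * t)).im| < 2 * Real.pi := by
  rw [b_im]; have := ht.2; nlinarith [Real.two_pi_pos]

lemma gG_diff (n : ℕ) (ω : ℝ) : DifferentiableOn ℂ (gG n ω) (stripG ω) := by
  unfold gG
  apply DifferentiableOn.const_mul
  apply (Complex.differentiableOn_dslope _).mpr
  · intro t ht
    apply DifferentiableAt.differentiableWithinAt
    unfold hG
    refine DifferentiableAt.div (by fun_prop) ?_ (mul_ne_zero (DD_ne_zero (a_lt ht))
      (DD_ne_zero (b_lt ht)))
    refine DifferentiableAt.mul ?_ ?_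
    · exact DD_diff.differentiableAt.comp t (by fun_prop)
    · exact DD_diff.differentiableAt.comp t (by fun_prop)
  · exact (isOpen_stripG ω).mem_nhds (by simp [stripG])

lemma gG_eq (n : ℕ) (ω : ℝ) (hω : 0 < ω) (t : ℂ) (h0 : t ≠ 0) :
    gG n ω t = fG n ω t - (-(if n = 0 then 1 else 0) / (4 * Real.pi ^ 2 * ω)) / t := by
  have hω' : (ω : ℂ) ≠ 0 := by exact_mod_cast hω.ne'
  have hpi : (Real.pi : ℂ) ≠ 0 := by exact_mod_cast Real.pi_ne_zero
  have ha : 2 * Real.pi * Complex.I * t ≠ 0 := by simp [h0]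
  have hb : -(2 * Real.pi * Complex.I * ω * t) ≠ 0 := by simp [h0, hω.ne']
  have hh0 : hG n ω 0 = if n = 0 then 1 else 0 := by
    simp [hG, DD_zero, zero_pow_eq]
  have hht : hG n ω t = -(4 * Real.pi ^ 2 * ω) * t * fG n ω t := by
    rw [hG, fG, DD_of_ne ha, DD_of_ne hb, div_mul_div_comm, div_div_eq_mul_div]
    rw [show 2 * Real.pi * Complex.I * t * -(2 * Real.pi * Complex.I * ω * t) =
      4 * Real.pi ^ 2 * ω * t ^ 2 by ring_nf; rw [Complex.I_sq]; ring]
    ring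
  rw [gG, dslope_of_ne _ h0, slope_def_field, hht, hh0]
  field_simp
  ring

lemma exp_inv_neg {x : ℂ} (h : Complex.exp x - 1 ≠ 0) :
    (Complex.exp (-x) - 1)⁻¹ = -1 - (Complex.exp x - 1)⁻¹ := by
  have h1 := Complex.exp_ne_zero x
  have h2 : Complex.exp (-x) - 1 = -(Complex.exp x - 1) / Complex.exp x := by
    rw [Complex.exp_neg]; field_simp; ring
  rw [h2]
  field_simp
  ring

lemma gG_symm (n : ℕ) (hn : Even n) (ω : ℝ) (hω : 0 < ω) (u : ℝ) (hu : 0 < u) :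
    gG n ω (u * Complex.I) + gG n ω (-u * Complex.I) =
      Complex.I ^ (n + 1) * ((u : ℂ) ^ (n + 1) * (Complex.exp ((2 * Real.pi * ω : ℝ) * u) - 1)⁻¹ -
        (u : ℂ) ^ (n + 1) * (Complex.exp ((2 * Real.pi : ℝ) * u) - 1)⁻¹) := by
  have hu' : (u : ℂ) ≠ 0 := by exact_mod_cast hu.ne'
  have h0 : (u : ℂ) * Complex.I ≠ 0 := by simp [hu']
  have h0' : -(u : ℂ) * Complex.I ≠ 0 := by simp [hu']
  rw [gG_eq n ω hω _ h0, gG_eq n ω hω _ h0', neg_mul, div_neg]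
  have e1 : (2 * Real.pi * Complex.I * (u * Complex.I) : ℂ) = -((2 * Real.pi : ℝ) * u) := by
    push_cast; ring_nf; rw [Complex.I_sq]; ring
  have e2 : (2 * Real.pi * Complex.I * ω * (u * Complex.I) : ℂ) = -((2 * Real.pi * ω : ℝ) * u) := by
    push_cast; ring_nf; rw [Complex.I_sq]; ring
  have ne (p : ℝ) (hp : 0 < p) : Complex.exp (p * u) - 1 ≠ 0 := by
    apply exp_ne_one_aux
    · simp [Real.pi_pos]
    · exact mul_ne_zero (by exact_mod_cast hp.ne') hu'
  have n1 := ne (2 * Real.pi) Real.two_pi_pos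
  have n2 := ne (2 * Real.pi * ω) (by positivity)
  rw [fG, fG, mul_neg, mul_neg, e1, e2, neg_neg, neg_neg, (hn.add_one).neg_pow, mul_pow]
  simp only [div_eq_mul_inv, mul_inv]
  rw [exp_inv_neg n1, exp_inv_neg n2]
  ring

lemma fG_bound (n : ℕ) (ω : ℝ) (hω : 0 < ω) : ∃ C : ℝ, 0 < C ∧ ∀ x u : ℝ, |x| ≤ 1 → 1 ≤ |u| →
    ‖fG n ω (x + u * Complex.I)‖ ≤ C * (1 + u ^ 2)⁻¹ := by
  obtain ⟨c1, hc1, H1⟩ := aux_bound (2 * Real.pi) (2 * Real.pi * ω) Real.two_pi_pos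
    (by positivity) (n + 3) (by omega)
  obtain ⟨c2, hc2, H2⟩ := aux_bound (2 * Real.pi * ω) (2 * Real.pi) (by positivity)
    Real.two_pi_pos (n + 3) (by omega)
  set c := min c1 c2 with hc
  have hcpos : 0 < c := lt_min hc1 hc2
  refine ⟨2 ^ (n + 2) / c, by positivity, fun x u hx hu => ?_⟩
  have hnum : ‖(x : ℂ) + u * Complex.I‖ ≤ 2 * |u| := by
    refine (norm_add_le _ _).trans ?_
    simp only [norm_mul, Complex.norm_I, Complex.norm_real, mul_one, Real.norm_eq_abs]
    linarith
  have hexp (z : ℂ) : |Real.exp z.re - 1| ≤ ‖Complex.exp z - 1‖ := by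
    have := abs_norm_sub_norm_le (Complex.exp z) 1
    simpa [Complex.norm_exp] using this
  have r1 : (2 * Real.pi * Complex.I * (x + u * Complex.I)).re = -(2 * Real.pi * u) := by simp
  have r2 : (-(2 * Real.pi * Complex.I * ω * (x + u * Complex.I))).re = 2 * Real.pi * ω * u := by
    simp
  have hden : c * |u| ^ (n + 3) ≤ ‖(Complex.exp (2 * Real.pi * Complex.I * (x + u * Complex.I)) - 1) *
    (Complex.exp (-(2 * Real.pi * Complex.I * ω * (x + u * Complex.I))) - 1)‖ := by
    rw [norm_mul]
    have q1 := hexp (2 * Real.pi * Complex.I * (x + u * Complex.I))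
    have q2 := hexp (-(2 * Real.pi * Complex.I * ω * (x + u * Complex.I)))
    rw [r1] at q1
    rw [r2] at q2
    refine le_trans ?_ (mul_le_mul q1 q2 (abs_nonneg _) (norm_nonneg _))
    rcases le_total 0 u with h | h
    · rw [abs_of_nonneg h] at hu ⊢
      have A := H1 u hu
      have B1 : 1 - Real.exp (-(2 * Real.pi * u)) ≤ |Real.exp (-(2 * Real.pi * u)) - 1| := by
        rw [abs_sub_comm]; exact le_abs_self _
      have B2 := le_abs_self (Real.exp (2 * Real.pi * ω * u) - 1)
      have B3 : 0 ≤ Real.exp (2 * Real.pi * ω * u) - 1 := by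
        rw [sub_nonneg]; apply Real.one_le_exp; positivity
      calc c * u ^ (n + 3) ≤ c1 * u ^ (n + 3) := by gcongr; exact min_le_left _ _
        _ ≤ _ := A
        _ ≤ _ := mul_le_mul B1 B2 B3 (abs_nonneg _)
    · rw [abs_of_nonpos h] at hu ⊢
      have A := H2 (-u) hu
      rw [mul_neg, neg_neg, mul_neg] at A
      have B1 : 1 - Real.exp (2 * Real.pi * ω * u) ≤ |Real.exp (2 * Real.pi * ω * u) - 1| := by
        rw [abs_sub_comm]; exact le_abs_self _
      have B2 := le_abs_self (Real.exp (-(2 * Real.pi * u)) - 1)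
      have B3 : 0 ≤ Real.exp (-(2 * Real.pi * u)) - 1 := by
        rw [sub_nonneg]; apply Real.one_le_exp; nlinarith [Real.pi_pos]
      rw [mul_comm |Real.exp (-(2 * Real.pi * u)) - 1|]
      calc c * (-u) ^ (n + 3) ≤ c2 * (-u) ^ (n + 3) := by
            have : 0 ≤ (-u) ^ (n + 3) := pow_nonneg (by linarith) _
            gcongr; exact min_le_right _ _
        _ ≤ _ := A
        _ ≤ _ := mul_le_mul B1 B2 B3 (abs_nonneg _)
  rw [fG, norm_div, norm_neg, norm_pow]
  have hu0 : 0 < |u| := by linarith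
  calc _ ≤ (2 * |u|) ^ (n + 1) / (c * |u| ^ (n + 3)) := by gcongr
    _ = 2 ^ (n + 1) / c * (|u| ^ 2)⁻¹ := by
      rw [mul_pow, show n + 3 = (n + 1) + 2 by ring, pow_add |u| (n + 1) 2]
      field_simp
    _ ≤ 2 ^ (n + 1) / c * (2 * (1 + u ^ 2)⁻¹) := by
      gcongr
      rw [← sq_abs u, ← div_eq_mul_inv, inv_le_comm₀ (by positivity) (by positivity), inv_div]
      nlinarith
    _ = _ := by ring

section
open Set Filter Topology

lemma symm_interval (F : ℝ → ℂ) (hF : Continuous F) (T : ℝ) :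
    ∫ u in (-T)..T, F u = ∫ u in (0 : ℝ)..T, (F u + F (-u)) := by
  have hF' : Continuous (fun u => F (-u)) := by fun_prop
  rw [intervalIntegral.integral_add (hF.intervalIntegrable _ _)
    (hF'.intervalIntegrable _ _), intervalIntegral.integral_comp_neg,
    neg_zero, add_comm, intervalIntegral.integral_add_adjacent_intervals
    (hF.intervalIntegrable _ _) (hF.intervalIntegrable _ _)]

lemma line_ne (ε : ℝ) (hε : 0 < ε) (u : ℝ) : (-ε : ℂ) + u * Complex.I ≠ 0 := by
  intro h
  have := congrArg Complex.re h
  simp at this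
  linarith

lemma pole_limit (ε : ℝ) (hε : 0 < ε) :
    Tendsto (fun T : ℝ => ∫ u in (-T)..T, ((-ε : ℂ) + u * Complex.I)⁻¹) atTop
      (𝓝 (-(Real.pi : ℂ))) := by
  have hF : Continuous (fun u : ℝ => ((-ε : ℂ) + u * Complex.I)⁻¹) :=
    Continuous.inv₀ (by fun_prop) (line_ne ε hε)
  have h1 (T : ℝ) : ∫ u in (-T)..T, ((-ε : ℂ) + u * Complex.I)⁻¹ =
      ((-2 * Real.arctan (T / ε) : ℝ) : ℂ) := by
    rw [symm_interval _ hF]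
    have h2 : ∀ u : ℝ, ((-ε : ℂ) + u * Complex.I)⁻¹ + ((-ε : ℂ) + (-u : ℝ) * Complex.I)⁻¹ =
        ((-2 * (1 / (1 + (u / ε) ^ 2) * (1 / ε)) : ℝ) : ℂ) := by
      intro u
      have n1 := line_ne ε hε u
      have n2 := line_ne ε hε (-u)
      have n3 : (ε : ℂ) ≠ 0 := by exact_mod_cast hε.ne'
      have n4 : (ε : ℂ) ^ 2 + u ^ 2 ≠ 0 := by
        have : 0 < ε ^ 2 + u ^ 2 := by positivity
        exact_mod_cast this.ne'
      have n5 : (1 : ℂ) + (u / ε) ^ 2 = (ε ^ 2 + u ^ 2) / ε ^ 2 := by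
        field_simp
      push_cast at n2 ⊢
      rw [n5, inv_add_inv n1 n2, show ((-ε : ℂ) + u * Complex.I) * (-ε + -u * Complex.I) =
        ε ^ 2 + u ^ 2 by ring_nf; rw [Complex.I_sq]; ring]
      field_simp
      ring
    rw [intervalIntegral.integral_congr (fun u _ => h2 u), intervalIntegral.integral_ofReal]
    congr 1
    rw [intervalIntegral.integral_eq_sub_of_hasDerivAt
      (f := fun u => -2 * Real.arctan (u / ε))]
    · simp
    · intro u _
      exact (((hasDerivAt_id u).div_const ε).arctan).const_mul (-2)
    · apply Continuous.intervalIntegrable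
      have (u : ℝ) : 1 + (u / ε) ^ 2 ≠ 0 := by positivity
      fun_prop (disch := assumption)
  simp_rw [h1]
  have h3 : Tendsto (fun T : ℝ => -2 * Real.arctan (T / ε)) atTop (𝓝 (-Real.pi)) := by
    have := ((tendsto_nhds_of_tendsto_nhdsWithin Real.tendsto_arctan_atTop).comp
      (tendsto_id.atTop_div_const hε)).const_mul (-2)
    convert! this using 2
    ring
  have := (Complex.continuous_ofReal.tendsto _).comp h3
  rw [Complex.ofReal_neg] at this
  exact this

lemma main_n (n : ℕ) (hn : Even n) (ω : ℝ) (hω : 0 < ω) (ε : ℝ) (hε : 0 < ε) (hε1 : ε < 1)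
    (hεω : ω * ε < 1) :
    ∫ u : ℝ, fG n ω (-ε + u * Complex.I) =
      Complex.I ^ (n + 1) * (((n + 1).factorial : ℂ) * riemannZeta (n + 2 : ℕ) /
          (2 * Real.pi * ω : ℝ) ^ (n + 2) -
        ((n + 1).factorial : ℂ) * riemannZeta (n + 2 : ℕ) / (2 * Real.pi : ℝ) ^ (n + 2)) -
      Real.pi * (-(if n = 0 then 1 else 0) / (4 * Real.pi ^ 2 * ω)) := by
  set r : ℂ := -(if n = 0 then 1 else 0) / (4 * Real.pi ^ 2 * ω) with hr
  obtain ⟨C, hC, HC⟩ := fG_bound n ω hω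
  have hstrip (x u : ℝ) (h1 : -ε ≤ x) (h2 : x ≤ 0) : (x : ℂ) + u * Complex.I ∈ stripG ω := by
    have : ((x : ℂ) + u * Complex.I).re = x := by simp
    rw [stripG, mem_ofPred_eq, this, abs_mul, abs_of_pos hω, abs_of_nonpos h2]
    constructor <;> nlinarith
  -- continuity on the line
  have hlineS (u : ℝ) : (-ε : ℂ) + u * Complex.I ∈ stripG ω := by
    have := hstrip (-ε) u le_rfl (by linarith)
    simpa using this
  have hgc1 : Continuous (fun u : ℝ => gG n ω (-ε + u * Complex.I)) :=
    (gG_diff n ω).continuousOn.comp_continuous (by fun_prop) hlineS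
  have hgc0 : Continuous (fun u : ℝ => gG n ω (u * Complex.I)) :=
    (gG_diff n ω).continuousOn.comp_continuous (by fun_prop) (fun u => by
      have := hstrip 0 u (by linarith) le_rfl
      simpa using this)
  have hpc : Continuous (fun u : ℝ => ((-ε : ℂ) + u * Complex.I)⁻¹) :=
    Continuous.inv₀ (by fun_prop) (line_ne ε hε)
  have hfg (u : ℝ) : fG n ω (-ε + u * Complex.I) =
      gG n ω (-ε + u * Complex.I) + r * ((-ε : ℂ) + u * Complex.I)⁻¹ := by
    rw [gG_eq n ω hω _ (line_ne ε hε u)]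
    ring
  have hfc : Continuous (fun u : ℝ => fG n ω (-ε + u * Complex.I)) := by
    simp_rw [hfg]
    exact hgc1.add (continuous_const.mul hpc)
  have hint : Integrable (fun u : ℝ => fG n ω (-ε + u * Complex.I)) := by
    refine hfc.locallyIntegrable.integrable_of_isBigO_cocompact
      (g := fun u : ℝ => (1 + u ^ 2)⁻¹) ?_ (integrable_inv_one_add_sq.integrableAtFilter _)
    refine Asymptotics.IsBigO.of_bound C ?_
    have : ∀ᶠ u : ℝ in cocompact ℝ, 1 ≤ ‖u‖ :=
      (tendsto_norm_cocompact_atTop (E := ℝ)).eventually_ge_atTop 1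
    filter_upwards [this] with u hu
    have := HC (-ε) u (by rw [abs_neg, abs_of_pos hε]; exact hε1.le) hu
    rw [Real.norm_of_nonneg (by positivity : (0 : ℝ) ≤ (1 + u ^ 2)⁻¹)]
    simpa using this
  have T1 : Tendsto (fun T : ℝ => ∫ u in (-T)..T, fG n ω (-ε + u * Complex.I)) atTop
      (𝓝 (∫ u : ℝ, fG n ω (-ε + u * Complex.I))) :=
    intervalIntegral_tendsto_integral hint tendsto_neg_atTop_atBot tendsto_id
  have T2 := pole_limit ε hε
  have hpc' : Continuous (fun u : ℝ => r * ((-ε : ℂ) + u * Complex.I)⁻¹) :=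
    continuous_const.mul hpc
  have T12 : Tendsto (fun T : ℝ => ∫ u in (-T)..T, gG n ω (-ε + u * Complex.I)) atTop
      (𝓝 ((∫ u : ℝ, fG n ω (-ε + u * Complex.I)) - r * -(Real.pi : ℂ))) := by
    refine (T1.sub (T2.const_mul r)).congr fun T => ?_
    rw [← intervalIntegral.integral_const_mul, ← intervalIntegral.integral_sub
      (hfc.intervalIntegrable _ _) (hpc'.intervalIntegrable _ _)]
    refine intervalIntegral.integral_congr fun u _ => ?_
    simp only [hfg]
    ring
  -- the imaginary axis
  obtain ⟨I1, J1⟩ := aux_zeta (n + 2) (by omega) (2 * Real.pi * ω) (by positivity)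
  obtain ⟨I2, J2⟩ := aux_zeta (n + 2) (by omega) (2 * Real.pi) (by positivity)
  rw [show n + 2 - 1 = n + 1 by omega] at I1 J1 I2 J2
  have T3 : Tendsto (fun T : ℝ => ∫ u in (-T)..T, gG n ω (u * Complex.I)) atTop
      (𝓝 (Complex.I ^ (n + 1) * (((n + 1).factorial : ℂ) * riemannZeta (n + 2 : ℕ) /
          (2 * Real.pi * ω : ℝ) ^ (n + 2) -
        ((n + 1).factorial : ℂ) * riemannZeta (n + 2 : ℕ) / (2 * Real.pi : ℝ) ^ (n + 2)))) := by
    rw [← J1, ← J2, ← integral_sub I1 I2, ← integral_const_mul]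
    refine (intervalIntegral_tendsto_integral_Ioi 0 ((I1.sub I2).const_mul _)
      tendsto_id).congr' ?_
    filter_upwards [eventually_ge_atTop 0] with T hT
    rw [symm_interval _ hgc0, id, intervalIntegral.integral_of_le hT,
      intervalIntegral.integral_of_le hT]
    refine setIntegral_congr_fun measurableSet_Ioc fun u hu => ?_
    have := gG_symm n hn ω hω u hu.1
    push_cast at this ⊢
    rw [this]
    simp only [Pi.sub_apply]
  -- horizontal sides
  have hbd : Tendsto (fun T : ℝ => (C * (1 + T ^ 2)⁻¹ + ‖r‖ * T⁻¹) * ε) atTop (𝓝 0) := by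
    have e1 : Tendsto (fun T : ℝ => (1 + T ^ 2)⁻¹) atTop (𝓝 0) :=
      tendsto_inv_atTop_zero.comp
        (tendsto_atTop_add_const_left _ _ (tendsto_pow_atTop (by norm_num)))
    have := ((e1.const_mul C).add (tendsto_inv_atTop_zero.const_mul ‖r‖)).mul_const ε
    simpa using this
  have hpt (x u T : ℝ) (hT : 1 ≤ T) (hu : |u| = T) (hx : x ∈ Set.uIoc (-ε) 0) :
      ‖gG n ω (x + u * Complex.I)‖ ≤ C * (1 + T ^ 2)⁻¹ + ‖r‖ * T⁻¹ := by
    rw [uIoc_of_le (by linarith)] at hx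
    have him : T ≤ ‖(x : ℂ) + u * Complex.I‖ := by
      have := Complex.abs_im_le_norm ((x : ℂ) + u * Complex.I)
      simpa [hu] using this
    have h0 : (x : ℂ) + u * Complex.I ≠ 0 := by
      rw [← norm_pos_iff]; linarith
    rw [gG_eq n ω hω _ h0]
    refine (norm_sub_le _ _).trans (add_le_add ?_ ?_)
    · have := HC x u (by rw [abs_of_nonpos hx.2]; linarith [hx.1]) (by rw [hu]; exact hT)
      rwa [← sq_abs u, hu] at this
    · rw [norm_div, div_eq_mul_inv]
      gcongr
  have T4 (σ : ℝ) (hσ : |σ| = 1) :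
      Tendsto (fun T : ℝ => ∫ x in (-ε)..0, gG n ω (x + (σ * T : ℝ) * Complex.I)) atTop (𝓝 0) := by
    refine squeeze_zero_norm' ?_ hbd
    filter_upwards [eventually_ge_atTop 1] with T hT
    have := intervalIntegral.norm_integral_le_of_norm_le_const (a := -ε) (b := 0)
      (fun x hx => hpt x (σ * T) T hT (by rw [abs_mul, hσ, one_mul, abs_of_pos (by linarith)]) hx)
    simpa [abs_of_pos hε] using this
  have T5 (T : ℝ) : ((∫ x in (-ε)..0, gG n ω (x + ((-1 : ℝ) * T : ℝ) * Complex.I)) -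
      ∫ x in (-ε)..0, gG n ω (x + ((1 : ℝ) * T : ℝ) * Complex.I)) +
      Complex.I * (∫ u in (-T)..T, gG n ω (u * Complex.I)) -
      Complex.I * (∫ u in (-T)..T, gG n ω (-ε + u * Complex.I)) = 0 := by
    have := Complex.integral_boundary_rect_eq_zero_of_differentiableOn (gG n ω)
      ⟨-ε, -T⟩ ⟨0, T⟩ ((gG_diff n ω).mono ?_)
    · simpa using this
    · intro t ht
      rw [mem_reProdIm] at ht
      have h1 := ht.1
      simp only at h1
      rw [uIcc_of_le (by linarith)] at h1
      have := hstrip t.re t.im h1.1 h1.2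
      rwa [Complex.re_add_im] at this
  have L := (((T4 (-1) (by simp)).sub (T4 1 (by simp))).add (T3.const_mul Complex.I)).sub
    (T12.const_mul Complex.I)
  simp_rw [T5] at L
  have E := tendsto_nhds_unique L tendsto_const_nhds
  have hI := Complex.I_ne_zero
  rw [sub_zero, zero_add, ← mul_sub] at E
  have E2 := (mul_eq_zero.mp E).resolve_left hI
  linear_combination -E2

end

theorem Gcont_even_integer (k : ℕ) (hk : 2 ≤ k) (hke : Even k)
    (ω : ℝ) (hω : 0 < ω) (ε : ℝ) (hε : 0 < ε) (hε1 : ε < 1) (hεω : ε < 1 / ω) :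
    Gcont (k : ℂ) ω ε =
      ((k - 1).factorial : ℂ) / (2 * Real.pi * Complex.I) ^ k *
          riemannZeta k * ((ω : ℂ) ^ (-(k : ℤ)) - 1) -
        (if k = 2 then 1 else 0) / (4 * Real.pi * Complex.I * ω) := by
  obtain ⟨n, rfl⟩ : ∃ n, k = n + 2 := ⟨k - 2, by omega⟩
  have hn : Even n := by
    rcases hke with ⟨m, hm⟩
    exact ⟨m - 1, by omega⟩
  have hεω' : ω * ε < 1 := by
    rw [lt_div_iff₀ hω] at hεω; linarith
  have hG : Gcont ((n + 2 : ℕ) : ℂ) ω ε =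
      Complex.I * ∫ u : ℝ, fG n ω (-ε + u * Complex.I) := by
    rw [Gcont, ← integral_const_mul]
    congr 1
    ext u
    rw [fG, show (((n + 2 : ℕ) : ℂ) - 1) = ((n + 1 : ℕ) : ℂ) by push_cast; ring, cpow_natCast,
      (hn.add_one).neg_pow]
  have hω' : (ω : ℂ) ≠ 0 := by exact_mod_cast hω.ne'
  have hpi : (Real.pi : ℂ) ≠ 0 := by exact_mod_cast Real.pi_ne_zero
  have hI := Complex.I_ne_zero
  have hIk : Complex.I ^ (n + 2) * Complex.I ^ (n + 2) = 1 := by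
    rw [← mul_pow, Complex.I_mul_I, hke.neg_one_pow]
  have hIinv : (Complex.I ^ (n + 2))⁻¹ = Complex.I ^ (n + 2) := inv_eq_of_mul_eq_one_left hIk
  have e : (if n + 2 = 2 then (1 : ℂ) else 0) = if n = 0 then 1 else 0 := by simp
  rw [hG, main_n n hn ω hω ε hε hε1 hεω', e, show n + 2 - 1 = n + 1 by omega, zpow_neg,
    zpow_natCast, mul_pow (2 * (Real.pi : ℂ)) Complex.I, div_eq_mul_inv _ (_ * Complex.I ^ (n + 2)),
    mul_inv _ (Complex.I ^ (n + 2)), hIinv]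
  push_cast
  rw [mul_pow _ (ω : ℂ)]
  have e3 : ((4 : ℂ) * Real.pi * Complex.I * ω)⁻¹ = -Complex.I * ((4 : ℂ) * (Real.pi : ℂ) * (ω : ℂ))⁻¹ := by
    simp only [mul_inv, Complex.inv_I]; ring
  rw [div_eq_mul_inv _ ((4 : ℂ) * Real.pi * Complex.I * ω), e3]
  field_simp
  ring
end
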